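/- Let T be a triangulated category, C₁ and C₂ subcategories. Then the star operation on strictly full subcategories closed under summands is associative in the sense that thick^{m}(C) ⋄ thick^{n}(C) ⊆ thick^{m+n}(C) for all m, n ≥ 0; consequently level is subadditive on exact triangles: if X → Y → Z → ΣX is an exact triangle, then level^C(Y) ≤ level^C(X) + level^C(Z). -/

import Mathlib

open CategoryTheory Limits Pretriangulated

universe v u

variable {C : Type u} [Category.{v} C] [Preadditive C] [HasZeroObject C]
  [HasShift C ℤ] [∀ n : ℤ, (shiftFunctor C n).Additive] [Pretriangulated C]

/-- The closure `add(S)` of a collection of objects under suspensions (shifts of either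
sign), finite direct sums and isomorphisms, viewed as a collection of objects. -/
inductive AddClosure (S : Set C) : C → Prop
  | of {X : C} (h : X ∈ S) : AddClosure S X
  | shift {X : C} (n : ℤ) : AddClosure S X → AddClosure S (X⟦n⟧)
  | sum {X Y : C} (b : BinaryBicone X Y) (hb : b.IsBilimit) :
      AddClosure S X → AddClosure S Y → AddClosure S b.pt
  | iso {X Y : C} (e : X ≅ Y) : AddClosure S X → AddClosure S Y

/-- `smd(S)`: the closure of `S` under direct summands (retracts). -/
def Smd (S : Set C) : Set C :=
  {X | ∃ (Z : C) (_ : Z ∈ S) (i : X ⟶ Z) (r : Z ⟶ X), i ≫ r = 𝟙 X}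

/-- `S₁ ⋆ S₂`: the objects `Y` fitting into an exact triangle `X → Y → Z → ΣX` with
`X ∈ S₁` and `Z ∈ S₂`. -/
def StarOp (S₁ S₂ : Set C) : Set C :=
  {Y | ∃ (X Z : C) (f : X ⟶ Y) (g : Y ⟶ Z) (h : Z ⟶ X⟦(1 : ℤ)⟧),
    X ∈ S₁ ∧ Z ∈ S₂ ∧ Triangle.mk f g h ∈ distTriang C}

/-- `S₁ ⋄ S₂ = smd(add(S₁) ⋆ add(S₂))`. -/
def Diamond (S₁ S₂ : Set C) : Set C :=
  Smd (StarOp {X | AddClosure S₁ X} {X | AddClosure S₂ X})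

/-- The `n`-th thickening `thick^n(S)`: `thick^0(S) = {0}`,
`thick^1(S) = smd(add(S))` and `thick^n(S) = thick^{n-1}(S) ⋄ thick^1(S)`. -/
def ThickN (S : Set C) : ℕ → Set C
  | 0 => {X | IsZero X}
  | 1 => Smd {X | AddClosure S X}
  | n + 2 => Diamond (ThickN S (n + 1)) (Smd {X | AddClosure S X})

/-- The level of `X` with respect to `S`: the least `n` with `X ∈ thick^n(S)`
(and `⊤` if there is no such `n`). -/
noncomputable def Level (S : Set C) (X : C) : ℕ∞ :=
  sInf {n : ℕ∞ | ∃ m : ℕ, n = m ∧ X ∈ ThickN S m}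

set_option linter.unusedSectionVars false

section wrappers

variable {X Y Z : C} {f : X ⟶ Y} {g : Y ⟶ Z} {h : Z ⟶ X⟦(1 : ℤ)⟧}

lemma dt_zero₁₂ (hT : Triangle.mk f g h ∈ distTriang C) : f ≫ g = 0 :=
  comp_distTriang_mor_zero₁₂ _ hT

lemma dt_zero₂₃ (hT : Triangle.mk f g h ∈ distTriang C) : g ≫ h = 0 :=
  comp_distTriang_mor_zero₂₃ _ hT

lemma dt_yoneda₂ (hT : Triangle.mk f g h ∈ distTriang C) {W : C} (q : Y ⟶ W) (hq : f ≫ q = 0) :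
    ∃ r : Z ⟶ W, q = g ≫ r :=
  Triangle.yoneda_exact₂ _ hT q hq

lemma dt_yoneda₃ (hT : Triangle.mk f g h ∈ distTriang C) {W : C} (q : Z ⟶ W) (hq : g ≫ q = 0) :
    ∃ r : X⟦(1 : ℤ)⟧ ⟶ W, q = h ≫ r :=
  Triangle.yoneda_exact₃ _ hT q hq

lemma dt_coyoneda₂ (hT : Triangle.mk f g h ∈ distTriang C) {W : C} (q : W ⟶ Y) (hq : q ≫ g = 0) :
    ∃ r : W ⟶ X, q = r ≫ f :=
  Triangle.coyoneda_exact₂ _ hT q hq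

lemma dt_complete (hT : Triangle.mk f g h ∈ distTriang C) {Y' Z' : C} {f' : X ⟶ Y'}
    {g' : Y' ⟶ Z'} {h' : Z' ⟶ X⟦(1 : ℤ)⟧} (hT' : Triangle.mk f' g' h' ∈ distTriang C)
    (c : Z ⟶ Z') (hc : h = c ≫ h') :
    ∃ b : Y ⟶ Y', f ≫ b = f' ∧ g ≫ c = b ≫ g' := by
  have key : h ≫ (𝟙 X)⟦(1 : ℤ)⟧' = c ≫ h' := by
    rw [CategoryTheory.Functor.map_id, Category.comp_id, hc]
  obtain ⟨b, h1, h2⟩ := complete_distinguished_triangle_morphism₂ _ _ hT hT' (𝟙 X) c key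
  exact ⟨b, h1.trans (Category.id_comp _), h2⟩

lemma dt_isIso (hT : Triangle.mk f g h ∈ distTriang C) (b : Y ⟶ Y) (h1 : f ≫ b = f)
    (h2 : g = b ≫ g) : IsIso b := by
  let φ : Triangle.mk f g h ⟶ Triangle.mk f g h :=
    { hom₁ := 𝟙 X
      hom₂ := b
      hom₃ := 𝟙 Z
      comm₁ := h1.trans (Category.id_comp _).symm
      comm₂ := (Category.comp_id g).trans h2
      comm₃ := by
        have : h ≫ (𝟙 X)⟦(1 : ℤ)⟧' = 𝟙 Z ≫ h := by
          rw [CategoryTheory.Functor.map_id, Category.comp_id, Category.id_comp]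
        exact this }
  exact isIso₂_of_isIso₁₃ φ hT hT
    (inferInstanceAs (IsIso (𝟙 X))) (inferInstanceAs (IsIso (𝟙 Z)))

lemma dt_iso (hT : Triangle.mk f g h ∈ distTriang C) {Y' : C} (e : Y ≅ Y') :
    Triangle.mk (f ≫ e.hom) (e.inv ≫ g) h ∈ distTriang C := by
  refine isomorphic_distinguished _ hT _
    (Triangle.isoMk _ _ (Iso.refl X) e.symm (Iso.refl Z) ?_ ?_ ?_)
  · have : (f ≫ e.hom) ≫ e.inv = 𝟙 X ≫ f := by simp
    exact this
  · have : (e.inv ≫ g) ≫ 𝟙 Z = e.inv ≫ g := by simp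
    exact this
  · have : h ≫ (𝟙 X)⟦(1 : ℤ)⟧' = 𝟙 Z ≫ h := by
      rw [CategoryTheory.Functor.map_id, Category.comp_id, Category.id_comp]
    exact this

end wrappers

/-- One step of the construction used instead of an octahedron. -/
lemma star_step {W Y D P : C} (w : W ⟶ Y) (c : Y ⟶ D) (d : D ⟶ W⟦(1 : ℤ)⟧)
    (hT : Triangle.mk w c d ∈ distTriang C) (p : P ⟶ D) :
    ∃ (W' D' : C) (i : W ⟶ W') (j : W' ⟶ P) (k : P ⟶ W⟦(1 : ℤ)⟧)
      (e : W' ⟶ Y) (q : D ⟶ D') (d' : D' ⟶ W'⟦(1 : ℤ)⟧),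
      Triangle.mk i j k ∈ distTriang C ∧ Triangle.mk e (c ≫ q) d' ∈ distTriang C ∧
      p ≫ q = 0 := by
  obtain ⟨W', i, j, h1⟩ := distinguished_cocone_triangle₂ (p ≫ d)
  obtain ⟨e, he1', he2'⟩ := dt_complete h1 hT p rfl
  obtain ⟨D', c', d', h2⟩ := distinguished_cocone_triangle e
  have z2 : e ≫ c' = 0 := dt_zero₁₂ h2
  have z1 : c ≫ d = 0 := dt_zero₂₃ hT
  obtain ⟨q, hq'⟩ := dt_yoneda₂ hT c' (by
    rw [← he1', Category.assoc, z2, comp_zero])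
  obtain ⟨r, hr'⟩ := dt_yoneda₃ h1 (p ≫ q) (by
    rw [← Category.assoc, he2', Category.assoc, ← hq', z2])
  refine ⟨W', D', i, j, p ≫ d, e, q - d ≫ r, d', h1, ?_, ?_⟩
  · have : c ≫ (q - d ≫ r) = c' := by
      rw [Preadditive.comp_sub, ← Category.assoc c d r, z1, zero_comp, sub_zero, hq']
    rw [this]; exact h2
  · rw [Preadditive.comp_sub, hr', Category.assoc, sub_self]

lemma star_assoc (P Q R : Set C) :
    StarOp P (StarOp Q R) ⊆ Smd (StarOp (StarOp P Q) R) := by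
  rintro Y ⟨X, Z, f, g, h, hX, ⟨A, B, a, b, b', hA, hB, hT'⟩, hT⟩
  obtain ⟨W, D, i, j, k, e, q, d, h1, h2, h3⟩ := star_step f g h hT a
  obtain ⟨t, ht'⟩ := dt_yoneda₂ hT' q h3
  obtain ⟨W', D', i', j', k', e', q', d', h1', h2', h3'⟩ := star_step e (g ≫ q) d h2 t
  obtain ⟨s, hs⟩ := dt_coyoneda₂ h2' (𝟙 Y) (by
    rw [ht']; simp [h3'])
  exact ⟨W', ⟨W, B, i', j', k', ⟨X, A, i, j, k, hX, hA, h1⟩, hB, h1'⟩, s, e', hs.symm⟩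

lemma smd_smd (P : Set C) : Smd (Smd P) ⊆ Smd P := by
  rintro X ⟨Y, ⟨Z, hZ, i, r, h⟩, i', r', h'⟩
  refine ⟨Z, hZ, i' ≫ i, r ≫ r', ?_⟩
  rw [Category.assoc, reassoc_of% h, h']

lemma subset_smd (P : Set C) : P ⊆ Smd P := fun X hX => ⟨X, hX, 𝟙 X, 𝟙 X, by simp⟩

lemma smd_mono {P Q : Set C} (h : P ⊆ Q) : Smd P ⊆ Smd Q := by
  rintro X ⟨Y, hY, i, r, e⟩
  exact ⟨Y, h hY, i, r, e⟩

lemma star_mono {P Q P' Q' : Set C} (h : P ⊆ P') (h' : Q ⊆ Q') : StarOp P Q ⊆ StarOp P' Q' := by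
  rintro X ⟨Y, Z, f, g, k, hY, hZ, hT⟩
  exact ⟨Y, Z, f, g, k, h hY, h' hZ, hT⟩

lemma star_smd_right (P Q : Set C) : StarOp P (Smd Q) ⊆ Smd (StarOp P Q) := by
  rintro Y ⟨X, Z, f, g, h, hX, ⟨Z', hZ', i, r, hir⟩, hT⟩
  obtain ⟨Y', f', g', hT'⟩ := distinguished_cocone_triangle₂ (r ≫ h)
  obtain ⟨u, hu1, hu2⟩ := dt_complete hT hT' i (by rw [reassoc_of% hir])
  obtain ⟨v, hv1, hv2⟩ := dt_complete hT' hT r rfl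
  have : IsIso (u ≫ v) := dt_isIso hT (u ≫ v)
    (by rw [← Category.assoc, hu1, hv1])
    (by rw [Category.assoc, ← hv2, ← Category.assoc, ← hu2, Category.assoc, hir,
      Category.comp_id])
  refine ⟨Y', ⟨X, Z', f', g', r ≫ h, hX, hZ', hT'⟩, u, v ≫ inv (u ≫ v), ?_⟩
  rw [← Category.assoc, IsIso.hom_inv_id]

/-- Closure under isomorphisms, shifts and binary sums. -/
structure SClosed (P : Set C) : Prop where
  iso : ∀ {X Y : C}, (X ≅ Y) → X ∈ P → Y ∈ P
  shift : ∀ {X : C} (n : ℤ), X ∈ P → X⟦n⟧ ∈ P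
  sum : ∀ {X Y : C}, X ∈ P → Y ∈ P → (X ⊞ Y) ∈ P

lemma SClosed.addClosure_subset {P : Set C} (hP : SClosed P) : {X | AddClosure P X} ⊆ P := by
  intro X hX
  induction hX with
  | of h => exact h
  | shift n _ ih => exact hP.shift n ih
  | sum b hb _ _ ih1 ih2 => exact hP.iso (biprod.uniqueUpToIso _ _ hb).symm (hP.sum ih1 ih2)
  | iso e _ ih => exact hP.iso e ih

lemma sclosed_addClosure (S : Set C) : SClosed {X | AddClosure S X} where
  iso e h := AddClosure.iso e h
  shift n h := AddClosure.shift n h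
  sum {X Y} h h' := AddClosure.sum (BinaryBiproduct.bicone X Y) (BinaryBiproduct.isBilimit X Y) h h'

lemma SClosed.smd {P : Set C} (hP : SClosed P) : SClosed (Smd P) where
  iso := by
    rintro X Y e ⟨Z, hZ, i, r, h⟩
    exact ⟨Z, hZ, e.inv ≫ i, r ≫ e.hom, by simp [reassoc_of% h]⟩
  shift := by
    rintro X n ⟨Z, hZ, i, r, h⟩
    exact ⟨Z⟦n⟧, hP.shift n hZ, i⟦n⟧', r⟦n⟧', by rw [← Functor.map_comp, h, CategoryTheory.Functor.map_id]⟩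
  sum := by
    rintro X Y ⟨Z, hZ, i, r, h⟩ ⟨Z', hZ', i', r', h'⟩
    exact ⟨Z ⊞ Z', hP.sum hZ hZ', biprod.map i i', biprod.map r r', by
      ext <;> simp [reassoc_of% h, reassoc_of% h']⟩

/-- A product indexed by `Bool` is a binary biproduct. -/
noncomputable def piBoolIso (F : Bool → C) : ∏ᶜ F ≅ F true ⊞ F false where
  hom := biprod.lift (Pi.π F true) (Pi.π F false)
  inv := Pi.lift (fun b => match b with
    | true => biprod.fst
    | false => biprod.snd)
  hom_inv_id := by
    apply Limits.Pi.hom_ext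
    rintro (_ | _) <;> simp
  inv_hom_id := by
    apply biprod.hom_ext <;> simp

lemma SClosed.star {P Q : Set C} (hP : SClosed P) (hQ : SClosed Q) : SClosed (StarOp P Q) where
  iso := by
    rintro X Y e ⟨U, V, f, g, h, hU, hV, hT⟩
    refine ⟨U, V, f ≫ e.hom, e.inv ≫ g, h, hU, hV, dt_iso hT e⟩
  shift := by
    rintro X n ⟨U, V, f, g, h, hU, hV, hT⟩
    exact ⟨_, _, _, _, _, hP.shift n hU, hQ.shift n hV, Triangle.shift_distinguished _ hT n⟩
  sum := by
    rintro X Y ⟨U, V, f, g, h, hU, hV, hT⟩ ⟨U', V', f', g', h', hU', hV', hT'⟩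
    let T : Bool → Triangle C := fun b => match b with
      | true => Triangle.mk f g h
      | false => Triangle.mk f' g' h'
    have hTT := productTriangle_distinguished T (by
      rintro (_ | _)
      · exact hT'
      · exact hT)
    have e1 := piBoolIso (fun j => (T j).obj₁)
    have e2 := piBoolIso (fun j => (T j).obj₂)
    have e3 := piBoolIso (fun j => (T j).obj₃)
    change _ ≅ U ⊞ U' at e1
    change _ ≅ X ⊞ Y at e2
    change _ ≅ V ⊞ V' at e3
    refine ⟨_, _, (productTriangle T).mor₁ ≫ e2.hom, e2.inv ≫ (productTriangle T).mor₂,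
      (productTriangle T).mor₃, hP.iso e1.symm (hP.sum hU hU'), hQ.iso e3.symm (hQ.sum hV hV'),
      dt_iso (f := (productTriangle T).mor₁) (g := (productTriangle T).mor₂)
        (h := (productTriangle T).mor₃) hTT e2⟩

lemma isZero_of_retract {X Z : C} (hZ : IsZero Z) (i : X ⟶ Z) (r : Z ⟶ X) (h : i ≫ r = 𝟙 X) :
    IsZero X := by
  rw [IsZero.iff_id_eq_zero, ← h, hZ.eq_of_tgt i 0, zero_comp]

lemma sclosed_thickN (S : Set C) : ∀ n, SClosed (ThickN S n)
  | 0 =>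
    { iso := fun e h => IsZero.of_iso h e.symm
      shift := fun n h => (CategoryTheory.shiftFunctor C n).map_isZero h
      sum := fun {X Y} hX hY => by
        change IsZero _
        change IsZero _ at hX
        change IsZero _ at hY
        rw [IsZero.iff_id_eq_zero]
        apply biprod.hom_ext
        · exact hX.eq_of_tgt _ _
        · exact hY.eq_of_tgt _ _ }
  | 1 => (sclosed_addClosure S).smd
  | _ + 2 => ((sclosed_addClosure _).star (sclosed_addClosure _)).smd

lemma smd_thickN (S : Set C) : ∀ n, Smd (ThickN S n) ⊆ ThickN S n
  | 0 => by
    rintro X ⟨Z, hZ, i, r, h⟩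
    exact isZero_of_retract hZ i r h
  | 1 => smd_smd _
  | _ + 2 => smd_smd _

lemma subset_addClosure (P : Set C) : P ⊆ {X | AddClosure P X} := fun _ h => AddClosure.of h

lemma star_thickN (S : Set C) (m : ℕ) :
    ∀ n, StarOp (ThickN S m) (ThickN S n) ⊆ ThickN S (m + n)
  | 0 => by
    rintro Y ⟨X, Z, f, g, h, hX, hZ, hT⟩
    have : IsIso f := (Triangle.isZero₃_iff_isIso₁ _ hT).1 hZ
    exact (sclosed_thickN S m).iso (asIso f) hX
  | 1 => by
    cases m with
    | zero =>
      rintro Y ⟨X, Z, f, g, h, hX, hZ, hT⟩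
      have : IsIso g := (Triangle.isZero₁_iff_isIso₂ _ hT).1 hX
      rw [Nat.zero_add]
      exact (sclosed_thickN S 1).iso (asIso g).symm hZ
    | succ k =>
      exact (star_mono (subset_addClosure _) (subset_addClosure _)).trans (subset_smd _)
  | n + 2 => by
    have ih := star_thickN S m (n + 1)
    have h1 : ThickN S (n + 2) ⊆ Smd (StarOp (ThickN S (n + 1)) (ThickN S 1)) :=
      smd_mono (star_mono (sclosed_thickN S (n + 1)).addClosure_subset
        (sclosed_thickN S 1).addClosure_subset)
    have h2 : Smd (StarOp (ThickN S (m + (n + 1))) (ThickN S 1)) ⊆ ThickN S (m + (n + 2)) :=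
      smd_mono (star_mono (subset_addClosure _) (subset_addClosure _))
    refine (star_mono subset_rfl h1).trans ((star_smd_right _ _).trans ?_)
    refine (smd_mono (star_assoc _ _ _)).trans ((smd_smd _).trans ?_)
    exact (smd_mono (star_mono ih subset_rfl)).trans h2

lemma level_le_or (S : Set C) (X : C) :
    Level S X = ⊤ ∨ ∃ m : ℕ, Level S X = m ∧ X ∈ ThickN S m := by
  by_cases h : {n : ℕ∞ | ∃ m : ℕ, n = m ∧ X ∈ ThickN S m}.Nonempty
  · exact Or.inr (csInf_mem h)
  · left
    rw [Set.not_nonempty_iff_eq_empty] at h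
    rw [Level, h, sInf_empty]

/-- In a triangulated category, `thick^m(S) ⋄ thick^n(S) ⊆
thick^{m+n}(S)` for all `m, n ≥ 0`; consequently level is subadditive on exact
triangles: if `X → Y → Z → ΣX` is an exact triangle, then
`level(Y) ≤ level(X) + level(Z)`. -/
theorem diamond_thickN_subset_and_level_subadditive (S : Set C) :
    (∀ m n : ℕ, Diamond (ThickN S m) (ThickN S n) ⊆ ThickN S (m + n)) ∧
    (∀ (X Y Z : C) (f : X ⟶ Y) (g : Y ⟶ Z) (h : Z ⟶ X⟦(1 : ℤ)⟧),
      (Triangle.mk f g h ∈ (distTriang C)) →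
        Level S Y ≤ Level S X + Level S Z) := by
  refine ⟨fun m n => ?_, fun X Y Z f g h hT => ?_⟩
  · exact (smd_mono ((star_mono (sclosed_thickN S m).addClosure_subset
      (sclosed_thickN S n).addClosure_subset).trans (star_thickN S m n))).trans (smd_thickN S _)
  · obtain hX | ⟨m, hm, hX⟩ := level_le_or S X
    · simp [hX]
    obtain hZ | ⟨n, hn, hZ⟩ := level_le_or S Z
    · simp [hZ]
    rw [hm, hn]
    exact sInf_le ⟨m + n, by simp, star_thickN S m n ⟨X, Z, f, g, h, hX, hZ, hT⟩⟩
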